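/- In the Laplacian gadget, the second-order effective interaction due to V₂ satisfies −E† V₂ G' V₂ E = (1/72)(−14·I₄ + 10·X⊗X − 2·X⊗I₂ − 2·I₂⊗X), for any matrix G' with G' = Π₊ G' Π₊ and G'·(Π_c H₀' Π_c)·Π₊ = Π₊. -/

import Mathlib

open Matrix
open scoped Kronecker

noncomputable section

/-- Index type for the Fock space of 9 fermionic modes, `ℂ^512`.
Modes `i1,i2,i3,j1,j2,j3,x,y,z` are labelled `0,…,8` in this order. -/
abbrev Idx := Fin 9 → Bool

abbrev Mat := Matrix Idx Idx ℂ

/-- Jordan–Wigner annihilation operator `a_k = Z^{⊗(k-1)} ⊗ σ⁻ ⊗ I^{⊗(9-k)}`,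
written entrywise in the occupation-number basis (`false` = unoccupied `|0⟩`). -/
def a (k : Fin 9) : Mat :=
  Matrix.of fun s t =>
    if t k = true ∧ s = Function.update t k false then
      (-1 : ℂ) ^ (Finset.univ.filter fun l => l < k ∧ t l = true).card
    else 0

/-- Creation operator `a_k†`. -/
def ad (k : Fin 9) : Mat := (a k)ᴴ

/-- The vacuum state `|vac⟩ = |0⟩^{⊗9}`. -/
def vac : Idx → ℂ := fun t => if t = (fun _ => false) then 1 else 0

/-- `√3` as a complex number. -/
def s3 : ℂ := (Real.sqrt 3 : ℝ)

/-- The edges of the constraint graph `G_c`: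
`{i1,i2},{i2,i3},{i1,i3},{j1,j2},{j2,j3},{j1,j3},{i2,x},{j2,x},{i3,y},{j3,y},{i1,z},{j1,z}`. -/
def edges : Finset (Fin 9 × Fin 9) :=
  {(0,1), (1,2), (0,2), (3,4), (4,5), (3,5), (1,6), (4,6), (2,7), (5,7), (0,8), (3,8)}

/-- Adjacency in the constraint graph `G_c`. -/
def Adj (k l : Fin 9) : Prop := (k, l) ∈ edges ∨ (l, k) ∈ edges

instance (k l : Fin 9) : Decidable (Adj k l) := by unfold Adj; infer_instance

/-- `S` is an independent set of the constraint graph `G_c`. -/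
def IndepSet (S : Finset (Fin 9)) : Prop := ∀ k ∈ S, ∀ l ∈ S, ¬ Adj k l

instance (S : Finset (Fin 9)) : Decidable (IndepSet S) := by unfold IndepSet; infer_instance

/-- The Fock basis state `|S⟩` with exactly the modes in `S` occupied. -/
def fock (S : Finset (Fin 9)) : Idx → ℂ :=
  fun t => if t = (fun k => decide (k ∈ S)) then 1 else 0

/-- The set of occupied modes of an occupation vector. -/
def suppOf (t : Idx) : Finset (Fin 9) := Finset.univ.filter fun k => t k = true

/-- The two-particle constrained subspace: the span of the Fock states `|S⟩` over
independent sets `S` of `G_c` with `|S| = 2`. -/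
def C2 : Submodule ℂ (Idx → ℂ) :=
  Submodule.span ℂ {v | ∃ S : Finset (Fin 9), IndepSet S ∧ S.card = 2 ∧ v = fock S}

/-- `Π_c`, the orthogonal projector onto the two-particle constrained subspace.
Since that subspace is spanned by standard (Fock) basis vectors, the orthogonal
projector is the diagonal 0/1 matrix supported on those coordinates. -/
def Pic : Mat :=
  Matrix.diagonal fun t => if IndepSet (suppOf t) ∧ (suppOf t).card = 2 then 1 else 0

/-- `H_{0,i} = I + (a_{i1}†a_{i2}+h.c.) + (a_{i2}†a_{i3}+h.c.) + (a_{i3}†a_{i1}+h.c.)`. -/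
def H0i : Mat :=
  1 + (ad 0 * a 1 + ad 1 * a 0) + (ad 1 * a 2 + ad 2 * a 1) + (ad 2 * a 0 + ad 0 * a 2)

/-- `H_{0,j}`, defined analogously on modes `j1,j2,j3`. -/
def H0j : Mat :=
  1 + (ad 3 * a 4 + ad 4 * a 3) + (ad 4 * a 5 + ad 5 * a 4) + (ad 5 * a 3 + ad 3 * a 5)

/-- `H₀ = H_{0,i} + H_{0,j}`. -/
def H0 : Mat := H0i + H0j

/-- `S_{·,b}` on modes `k1,k2,k3`:
`S_{·,0} = (1/(2√3))((1−√3)a_{k3}† − 2a_{k1}† + (1+√3)a_{k2}†)` and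
`S_{·,1} = (1/(2√3))((1+√3)a_{k3}† − 2a_{k1}† + (1−√3)a_{k2}†)`. -/
def Senc (k1 k2 k3 : Fin 9) (b : Fin 2) : Mat :=
  if b = 0 then
    (1 / (2 * s3)) • ((1 - s3) • ad k3 - (2 : ℂ) • ad k1 + (1 + s3) • ad k2)
  else
    (1 / (2 * s3)) • ((1 + s3) • ad k3 - (2 : ℂ) • ad k1 + (1 - s3) • ad k2)

/-- The encoded two-qubit state `|bb'⟩_enc = S_{i,b} S_{j,b'} |vac⟩`. -/
def enc (b b' : Fin 2) : Idx → ℂ := (Senc 0 1 2 b * Senc 3 4 5 b').mulVec vac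

/-- The encoding isometry `E : ℂ⁴ → ℂ^512`, sending `|b⟩⊗|b'⟩` to `|bb'⟩_enc`. -/
def Eenc : Matrix Idx (Fin 2 × Fin 2) ℂ := Matrix.of fun t p => enc p.1 p.2 t

/-- `Π₋ = E E†`, the orthogonal projector onto the span of the four encoded states. -/
def Pim : Mat := Eenc * Eencᴴ

/-- `Π₊ = Π_c − Π₋`. -/
def Pip : Mat := Pic - Pim

/-- `V₁ = (a_{i2}†a_x+h.c.) + (a_{j2}†a_x+h.c.) + (a_{i3}†a_y+h.c.) + (a_{j3}†a_y+h.c.)`. -/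
def V1 : Mat :=
  (ad 1 * a 6 + ad 6 * a 1) + (ad 4 * a 6 + ad 6 * a 4)
    + (ad 2 * a 7 + ad 7 * a 2) + (ad 5 * a 7 + ad 7 * a 5)

/-- `V₂ = (a_{i1}†a_z+h.c.) + (a_{j1}†a_z+h.c.)`. -/
def V2 : Mat := (ad 0 * a 8 + ad 8 * a 0) + (ad 3 * a 8 + ad 8 * a 3)

/-- `V_main = V₁ + V₂`. -/
def Vmain : Mat := V1 + V2

/-- The Pauli matrix `X`. -/
def PX : Matrix (Fin 2) (Fin 2) ℂ := !![0, 1; 1, 0]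

/-- The Pauli matrix `Z`. -/
def PZ : Matrix (Fin 2) (Fin 2) ℂ := !![1, 0; 0, -1]

/-- `P_k = ∏_{l : {k,l} ∈ E(G_c)} (I − n_l)`, the product over the neighbours of
`k` in the constraint graph (the factors pairwise commute, so the product is
taken over the neighbours listed in increasing order). -/
def Pk (k : Fin 9) : Mat :=
  ((((Finset.univ.filter fun l => Adj k l)).sort (· ≤ ·)).map
    fun l => (1 : Mat) - ad l * a l).prod

/-- The Laplacian-gadget unperturbed Hamiltonian
`H₀' = (a_{i1}†a_{i2}+h.c.) + (a_{i2}†a_{i3}+h.c.) + (a_{i3}†a_{i1}+h.c.)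
     + (a_{j1}†a_{j2}+h.c.) + (a_{j2}†a_{j3}+h.c.) + (a_{j3}†a_{j1}+h.c.)
     + P_{i1} + P_{i2} + P_{i3} + P_{j1} + P_{j2} + P_{j3}`. -/
def H0' : Mat :=
  (ad 0 * a 1 + ad 1 * a 0) + (ad 1 * a 2 + ad 2 * a 1) + (ad 2 * a 0 + ad 0 * a 2)
    + (ad 3 * a 4 + ad 4 * a 3) + (ad 4 * a 5 + ad 5 * a 4) + (ad 5 * a 3 + ad 3 * a 5)
    + Pk 0 + Pk 1 + Pk 2 + Pk 3 + Pk 4 + Pk 5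

section FockStates

/-- The Jordan–Wigner sign `(-1)^{#{l ∈ S : l < k}}`. -/
def jwSign (k : Fin 9) (S : Finset (Fin 9)) : ℂ := (-1) ^ (S.filter (· < k)).card

theorem mulVec_fock (M : Mat) (S : Finset (Fin 9)) :
    M *ᵥ fock S = fun s => M s fun k => decide (k ∈ S) := by
  ext s
  simp [mulVec, dotProduct, fock]

theorem indicator_injective :
    Function.Injective fun (S : Finset (Fin 9)) (k : Fin 9) => decide (k ∈ S) := by
  intro S T h
  ext k
  simpa using congrFun h k

theorem fock_apply_indicator (S T : Finset (Fin 9)) :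
    fock S (fun k => decide (k ∈ T)) = if T = S then 1 else 0 := by
  simp only [fock]
  exact if_congr indicator_injective.eq_iff rfl rfl

theorem vac_eq_fock : vac = fock ∅ := by
  ext t
  simp [vac, fock]

theorem star_fock (S : Finset (Fin 9)) : star (fock S) = fock S := by
  ext t
  simp [fock, apply_ite]

theorem fock_dotProduct_fock (S T : Finset (Fin 9)) :
    fock S ⬝ᵥ fock T = if S = T then 1 else 0 := by
  have h : fock S ⬝ᵥ fock T = fock T fun k => decide (k ∈ S) := by
    simp [dotProduct, fock, eq_comm]
  rw [h, fock_apply_indicator]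

theorem a_mulVec_fock (k : Fin 9) (S : Finset (Fin 9)) :
    a k *ᵥ fock S = if k ∈ S then jwSign k S • fock (S.erase k) else 0 := by
  have hupd : Function.update (fun l => decide (l ∈ S)) k false
      = fun l => decide (l ∈ S.erase k) := by
    ext l
    by_cases h : l = k <;> simp [h]
  have hfilter : (Finset.univ.filter fun l => l < k ∧ l ∈ S) = S.filter (· < k) := by
    ext l
    simp [and_comm]
  rw [mulVec_fock]
  ext s
  by_cases hk : k ∈ S <;> simp [a, fock, hk, hupd, hfilter, jwSign]

theorem ad_mulVec_fock (k : Fin 9) (S : Finset (Fin 9)) :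
    ad k *ᵥ fock S = if k ∈ S then 0 else jwSign k S • fock (insert k S) := by
  rw [mulVec_fock]
  ext s
  have hiff : (s k = true ∧ (fun l => decide (l ∈ S)) = Function.update s k false) ↔
      k ∉ S ∧ s = fun l => decide (l ∈ insert k S) := by
    constructor
    · rintro ⟨hs, h⟩
      refine ⟨by simpa using congrFun h k, ?_⟩
      ext l
      by_cases hl : l = k
      · simp [hl, hs]
      · simpa [hl, eq_comm] using congrFun h l
    · rintro ⟨hk, rfl⟩
      refine ⟨by simp, ?_⟩
      ext l
      by_cases hl : l = k <;> simp [hl, hk]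
  simp only [ad, conjTranspose_apply, a, of_apply]
  by_cases h : k ∉ S ∧ s = fun l => decide (l ∈ insert k S)
  · rw [if_pos (hiff.2 h), if_neg h.1]
    have hfilter : (Finset.univ.filter fun l => l < k ∧ s l = true) = S.filter (· < k) := by
      ext l
      simp only [h.2, Finset.mem_filter, Finset.mem_univ, true_and, decide_eq_true_eq,
        Finset.mem_insert]
      constructor
      · rintro ⟨hlt, rfl | hl⟩
        · exact absurd hlt (lt_irrefl _)
        · exact ⟨hl, hlt⟩
      · rintro ⟨hl, hlt⟩
        exact ⟨hlt, Or.inr hl⟩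
    rw [hfilter]
    rw [star_pow, star_neg, star_one, Pi.smul_apply, fock, if_pos h.2, smul_eq_mul, mul_one,
      jwSign]
  · rw [if_neg (mt hiff.1 h)]
    by_cases hk : k ∈ S
    · simp [hk]
    · have hs : ¬ s = fun l => decide (l ∈ insert k S) := fun hs => h ⟨hk, hs⟩
      rw [if_neg hk, Pi.smul_apply, fock, if_neg hs]
      simp

theorem jwSign_mul_self (k : Fin 9) (S : Finset (Fin 9)) : jwSign k S * jwSign k S = 1 := by
  rw [jwSign, ← mul_pow]
  norm_num

theorem jwSign_singleton (k q : Fin 9) : jwSign k {q} = if q < k then -1 else 1 := by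
  by_cases h : q < k <;> simp [jwSign, Finset.filter_singleton, h]

theorem jwSign_pair (p q : Fin 9) : jwSign p {p, q} = jwSign p {q} := by
  simp [jwSign, Finset.filter_insert]

theorem one_sub_number_mulVec_fock (l : Fin 9) (S : Finset (Fin 9)) :
    (1 - ad l * a l) *ᵥ fock S = if l ∈ S then 0 else fock S := by
  rw [sub_mulVec, one_mulVec, ← mulVec_mulVec, a_mulVec_fock]
  by_cases h : l ∈ S
  · have hsign : jwSign l (S.erase l) = jwSign l S := by
      rw [jwSign, jwSign, Finset.filter_erase, Finset.erase_eq_of_notMem (by simp)]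
    simp [h, mulVec_smul, ad_mulVec_fock, hsign, smul_smul, jwSign_mul_self]
  · simp [h]

theorem Pk_mulVec_fock (k : Fin 9) (S : Finset (Fin 9)) :
    Pk k *ᵥ fock S = if ∃ l ∈ S, Adj k l then 0 else fock S := by
  have hprod (L : List (Fin 9)) : (L.map fun l => (1 : Mat) - ad l * a l).prod *ᵥ fock S
      = if ∃ l ∈ S, l ∈ L then 0 else fock S := by
    induction L with
    | nil => simp
    | cons l L ih =>
      rw [List.map_cons, List.prod_cons, ← mulVec_mulVec, ih]
      by_cases hL : ∃ m ∈ S, m ∈ L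
      · obtain ⟨m, hm, hmL⟩ := hL
        rw [if_pos ⟨m, hm, hmL⟩, if_pos ⟨m, hm, List.mem_cons_of_mem _ hmL⟩, mulVec_zero]
      · rw [if_neg hL, one_sub_number_mulVec_fock]
        refine if_congr ⟨fun h => ⟨l, h, List.mem_cons_self⟩, ?_⟩ rfl rfl
        rintro ⟨m, hm, hmL⟩
        rcases List.mem_cons.1 hmL with rfl | hmL
        · exact hm
        · exact absurd ⟨m, hm, hmL⟩ hL
  rw [Pk, hprod]
  simp

theorem Pic_mulVec_fock (S : Finset (Fin 9)) :
    Pic *ᵥ fock S = if IndepSet S ∧ S.card = 2 then fock S else 0 := by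
  ext t
  rw [Pic, mulVec_diagonal]
  by_cases ht : t = fun k => decide (k ∈ S)
  · have hS : suppOf t = S := by
      ext k
      simp [suppOf, ht]
    rw [hS]
    split_ifs <;> simp
  · split_ifs <;> simp [fock, ht]

theorem hop_mulVec_fock_left {k p q : Fin 9} (hpq : p ≠ q) :
    (ad k * a p) *ᵥ fock {p, q}
      = if k = q then 0 else (jwSign p {q} * jwSign k {q}) • fock {k, q} := by
  have herase : ({p, q} : Finset (Fin 9)).erase p = {q} := by
    rw [Finset.erase_insert (by simpa using hpq)]
  rw [← mulVec_mulVec, a_mulVec_fock, if_pos (by simp), herase, mulVec_smul, ad_mulVec_fock,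
    jwSign_pair]
  by_cases hk : k = q <;> simp [hk, smul_smul]

/-- Hopping of one particle of a two-particle state, with its Jordan–Wigner sign. -/
theorem hop_mulVec_fock_pair (k l p q : Fin 9) (hpq : p ≠ q) :
    (ad k * a l) *ᵥ fock {p, q}
      = if l = p then if k = q then 0 else (jwSign p {q} * jwSign k {q}) • fock {k, q}
        else if l = q then if k = p then 0 else (jwSign q {p} * jwSign k {p}) • fock {p, k}
        else 0 := by
  by_cases hp : l = p
  · subst hp
    rw [if_pos rfl, hop_mulVec_fock_left hpq]
  · rw [if_neg hp]
    by_cases hq : l = q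
    · subst hq
      rw [if_pos rfl, Finset.pair_comm, hop_mulVec_fock_left hpq.symm, Finset.pair_comm k]
    · rw [if_neg hq, ← mulVec_mulVec, a_mulVec_fock, if_neg (by simp [hp, hq]), mulVec_zero]

end FockStates

section Encoding

/-- The amplitudes of `S_{·,b}` on its three modes. -/
def amp (b : Fin 2) : Fin 3 → ℂ :=
  if b = 0 then ![-2 / (2 * s3), (1 + s3) / (2 * s3), (1 - s3) / (2 * s3)]
  else ![-2 / (2 * s3), (1 - s3) / (2 * s3), (1 + s3) / (2 * s3)]

theorem s3_sq : s3 ^ 2 = 3 := by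
  rw [s3, ← Complex.ofReal_pow, Real.sq_sqrt (by norm_num)]
  norm_num

theorem s3_ne_zero : s3 ≠ 0 := by
  intro h
  simpa [h] using s3_sq

theorem star_amp (b : Fin 2) (m : Fin 3) : star (amp b m) = amp b m := by
  fin_cases b <;> fin_cases m <;> simp [amp, s3]

theorem amp_zero_mul_amp_zero (b c : Fin 2) : amp b 0 * amp c 0 = 1 / 3 := by
  have hs := s3_sq
  have hs0 := s3_ne_zero
  fin_cases b <;> fin_cases c <;> simp [amp] <;> field_simp <;> linear_combination -hs

theorem amp_form (b c : Fin 2) :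
    amp b 1 * (3 * amp c 1 - amp c 2) + amp b 2 * (3 * amp c 2 - amp c 1)
      = if b = c then 7 / 3 else -5 / 3 := by
  have hs := s3_sq
  have hs0 := s3_ne_zero
  fin_cases b <;> fin_cases c <;> simp [amp] <;> field_simp <;> ring_nf <;> simp [hs] <;> norm_num

theorem Senc_eq (k1 k2 k3 : Fin 9) (b : Fin 2) :
    Senc k1 k2 k3 b = amp b 0 • ad k1 + amp b 1 • ad k2 + amp b 2 • ad k3 := by
  fin_cases b <;> simp [Senc, amp] <;> module

theorem ad_mul_ad_mulVec_vac {k l : Fin 9} (h : k < l) :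
    (ad k * ad l) *ᵥ vac = fock {k, l} := by
  rw [vac_eq_fock, ← mulVec_mulVec, ad_mulVec_fock]
  have hl : jwSign l ∅ = 1 := by simp [jwSign]
  simp [ad_mulVec_fock, h.ne, jwSign_singleton, h.le.not_gt, hl]

theorem enc_eq (b b' : Fin 2) :
    enc b b' = (amp b 0 * amp b' 0) • fock {0, 3} + (amp b 0 * amp b' 1) • fock {0, 4}
      + (amp b 0 * amp b' 2) • fock {0, 5} + (amp b 1 * amp b' 0) • fock {1, 3}
      + (amp b 1 * amp b' 1) • fock {1, 4} + (amp b 1 * amp b' 2) • fock {1, 5}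
      + (amp b 2 * amp b' 0) • fock {2, 3} + (amp b 2 * amp b' 1) • fock {2, 4}
      + (amp b 2 * amp b' 2) • fock {2, 5} := by
  simp only [enc, Senc_eq, add_mul, mul_add, smul_mul_smul_comm, add_mulVec, smul_mulVec]
  repeat rw [ad_mul_ad_mulVec_vac (by decide)]
  module

/-- The image of `|bb'⟩_enc` under `V₂`. -/
theorem V2_mulVec_enc (b b' : Fin 2) :
    V2 *ᵥ enc b b' =
      (-amp b 0) • (amp b' 0 • fock {3, 8} + amp b' 1 • fock {4, 8} + amp b' 2 • fock {5, 8})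
      + amp b' 0 • (amp b 0 • fock {0, 8} + amp b 1 • fock {1, 8} + amp b 2 • fock {2, 8}) := by
  have h (k l : Fin 9) (hk : k < 3) (hl : 3 ≤ l ∧ l < 6) : V2 *ᵥ fock {k, l}
      = (if k = 0 then -fock {l, 8} else 0) + if l = 3 then fock {k, 8} else 0 := by
    have hkl : k ≠ l := (hk.trans_le hl.1).ne
    have hl8 : l < 8 := hl.2.trans (by decide)
    have hk8 : k < 8 := (hk.trans_le hl.1).trans hl8
    have hk3 : k ≠ 3 := hk.ne
    have hl0 : l ≠ 0 := by rintro rfl; exact absurd hl.1 (by decide)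
    have hl3 : ¬ l < 3 := hl.1.not_gt
    simp only [V2, add_mulVec, hop_mulVec_fock_pair _ _ _ _ hkl, jwSign_singleton,
      hl8.ne', hk8.ne', hl8, hk8, hk3.symm, hl0.symm, if_false, if_true, Finset.pair_comm 8 l]
    by_cases h0 : k = 0 <;> by_cases h3 : l = 3 <;>
      simp [h0, h3, eq_comm (a := (0 : Fin 9)), eq_comm (a := (3 : Fin 9)), hk]
  rw [enc_eq]
  simp only [mulVec_add, mulVec_smul]
  repeat rw [h _ _ (by decide) (by decide)]
  simp
  module

theorem Eenc_conjTranspose_mulVec_fock {S : Finset (Fin 9)} (hS : 8 ∈ S) :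
    Eencᴴ *ᵥ fock S = 0 := by
  have hne (k l : Fin 9) (hk : 8 ≠ k) (hl : 8 ≠ l) : S ≠ {k, l} := by
    rintro rfl
    simp [hk, hl] at hS
  ext p
  have h : (Eencᴴ *ᵥ fock S) p = star (enc p.1 p.2 fun k => decide (k ∈ S)) := by
    simp [mulVec, dotProduct, fock, Eenc]
  rw [h, enc_eq]
  simp only [Pi.add_apply, Pi.smul_apply, fock_apply_indicator]
  simp [hne]

theorem Pip_mulVec_fock {S : Finset (Fin 9)} (hS : 8 ∈ S) : Pip *ᵥ fock S = Pic *ᵥ fock S := by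
  rw [Pip, sub_mulVec, Pim, ← mulVec_mulVec, Eenc_conjTranspose_mulVec_fock hS, mulVec_zero,
    sub_zero]

/-- The solution `w ∈ im Π₊` of `Π_c H₀' Π_c w = Π₊ V₂ |bb'⟩_enc`. -/
def intermediateState (b b' : Fin 2) : Idx → ℂ :=
  (-amp b 0 / 8) • ((3 * amp b' 1 - amp b' 2) • fock {4, 8}
      + (3 * amp b' 2 - amp b' 1) • fock {5, 8})
    + (amp b' 0 / 8) • ((3 * amp b 1 - amp b 2) • fock {1, 8}
      + (3 * amp b 2 - amp b 1) • fock {2, 8})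

theorem Pic_mulVec_allowed {k : Fin 9} (hk : k ∈ ({1, 2, 4, 5} : Finset (Fin 9))) :
    Pic *ᵥ fock {k, 8} = fock {k, 8} := by
  rw [Pic_mulVec_fock, if_pos]
  revert k
  decide

theorem Pic_mulVec_forbidden {k : Fin 9} (hk : k ∈ ({0, 3} : Finset (Fin 9))) :
    Pic *ᵥ fock {k, 8} = 0 := by
  rw [Pic_mulVec_fock, if_neg]
  revert k
  decide

theorem Pip_mulVec_intermediateState (b b' : Fin 2) :
    Pip *ᵥ intermediateState b b' = intermediateState b b' := by
  simp only [intermediateState, mulVec_add, mulVec_smul]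
  repeat rw [Pip_mulVec_fock (by decide)]
  repeat rw [Pic_mulVec_allowed (by decide)]

theorem Pip_mulVec_V2_mulVec_enc (b b' : Fin 2) :
    Pip *ᵥ (V2 *ᵥ enc b b') =
      (-amp b 0) • (amp b' 1 • fock {4, 8} + amp b' 2 • fock {5, 8})
      + amp b' 0 • (amp b 1 • fock {1, 8} + amp b 2 • fock {2, 8}) := by
  simp only [V2_mulVec_enc, mulVec_add, mulVec_smul]
  repeat rw [Pip_mulVec_fock (by decide)]
  rw [Pic_mulVec_forbidden (k := 0) (by decide), Pic_mulVec_forbidden (k := 3) (by decide)]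
  repeat rw [Pic_mulVec_allowed (by decide)]
  module

theorem H0'_mulVec_fock {k l m : Fin 9}
    (h : (m, k, l) ∈ ({(0, 1, 2), (0, 2, 1), (3, 4, 5), (3, 5, 4)} : Finset _)) :
    H0' *ᵥ fock {k, 8} = (3 : ℂ) • fock {k, 8} + fock {l, 8} + fock {m, 8} := by
  simp only [Finset.mem_insert, Finset.mem_singleton, Prod.mk.injEq] at h
  rcases h with ⟨rfl, rfl, rfl⟩ | ⟨rfl, rfl, rfl⟩ | ⟨rfl, rfl, rfl⟩ | ⟨rfl, rfl, rfl⟩ <;>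
  · simp only [H0', add_mulVec, Pk_mulVec_fock]
    repeat rw [hop_mulVec_fock_pair _ _ _ _ (by decide)]
    simp [jwSign_singleton, Adj, edges]
    module

theorem compressed_H0'_mulVec_fock {k l m : Fin 9}
    (h : (m, k, l) ∈ ({(0, 1, 2), (0, 2, 1), (3, 4, 5), (3, 5, 4)} : Finset _)) :
    (Pic * H0' * Pic) *ᵥ fock {k, 8} = (3 : ℂ) • fock {k, 8} + fock {l, 8} := by
  have hmem : m ∈ ({0, 3} : Finset (Fin 9)) ∧ k ∈ ({1, 2, 4, 5} : Finset (Fin 9)) ∧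
      l ∈ ({1, 2, 4, 5} : Finset (Fin 9)) := by
    simp only [Finset.mem_insert, Finset.mem_singleton, Prod.mk.injEq] at h
    rcases h with ⟨rfl, rfl, rfl⟩ | ⟨rfl, rfl, rfl⟩ | ⟨rfl, rfl, rfl⟩ | ⟨rfl, rfl, rfl⟩ <;> decide
  rw [← mulVec_mulVec, ← mulVec_mulVec, Pic_mulVec_allowed hmem.2.1, H0'_mulVec_fock h,
    mulVec_add, mulVec_add, mulVec_smul, Pic_mulVec_allowed hmem.2.1,
    Pic_mulVec_allowed hmem.2.2, Pic_mulVec_forbidden hmem.1, add_zero]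

theorem compressed_H0'_mulVec_intermediateState (b b' : Fin 2) :
    (Pic * H0' * Pic) *ᵥ intermediateState b b' = Pip *ᵥ (V2 *ᵥ enc b b') := by
  rw [Pip_mulVec_V2_mulVec_enc]
  simp only [intermediateState, mulVec_add, mulVec_smul]
  rw [compressed_H0'_mulVec_fock (m := 0) (k := 1) (l := 2) (by decide),
    compressed_H0'_mulVec_fock (m := 0) (k := 2) (l := 1) (by decide),
    compressed_H0'_mulVec_fock (m := 3) (k := 4) (l := 5) (by decide),
    compressed_H0'_mulVec_fock (m := 3) (k := 5) (l := 4) (by decide)]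
  module

theorem V2_conjTranspose : V2ᴴ = V2 := by
  simp only [V2, ad, conjTranspose_add, conjTranspose_mul, conjTranspose_conjTranspose]
  abel

theorem star_V2_mulVec_enc_dotProduct_intermediateState (b b' c c' : Fin 2) :
    star (V2 *ᵥ enc b b') ⬝ᵥ intermediateState c c' =
      amp b 0 * amp c 0 / 8 * (amp b' 1 * (3 * amp c' 1 - amp c' 2)
        + amp b' 2 * (3 * amp c' 2 - amp c' 1))
      + amp b' 0 * amp c' 0 / 8 * (amp b 1 * (3 * amp c 1 - amp c 2)
        + amp b 2 * (3 * amp c 2 - amp c 1)) := by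
  have hset (k l : Fin 9) (hk : k ≠ 8) (hl : l ≠ 8) :
      ({k, 8} : Finset (Fin 9)) = {l, 8} ↔ k = l := by
    revert k l
    decide
  simp only [V2_mulVec_enc, intermediateState, star_add, star_smul, star_neg, star_amp, star_fock,
    add_dotProduct, dotProduct_add, smul_dotProduct, dotProduct_smul, fock_dotProduct_fock]
  repeat rw [if_congr (hset _ _ (by decide) (by decide)) rfl rfl]
  simp
  ring

end Encoding

/-!
STATEMENT 16: In the Laplacian gadget, the second-order effective interaction
due to `V₂`: `−E† V₂ G' V₂ E = (1/72)(−14·I₄ + 10·X⊗X − 2·X⊗I₂ − 2·I₂⊗X)` for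
any `G'` with `G' = Π₊ G' Π₊` and `G' (Π_c H₀' Π_c) Π₊ = Π₊`.
-/

theorem statement16 (G' : Mat) (hG : G' = Pip * G' * Pip)
    (hGinv : G' * (Pic * H0' * Pic) * Pip = Pip) :
    -(Eencᴴ * V2 * G' * V2 * Eenc) =
      (1 / 72 : ℂ) •
        ((-14 : ℂ) • (1 : Matrix (Fin 2 × Fin 2) (Fin 2 × Fin 2) ℂ)
          + (10 : ℂ) • (PX ⊗ₖ PX)
          - (2 : ℂ) • (PX ⊗ₖ (1 : Matrix (Fin 2) (Fin 2) ℂ))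
          - (2 : ℂ) • ((1 : Matrix (Fin 2) (Fin 2) ℂ) ⊗ₖ PX)) := by
  have hcol (q : Fin 2 × Fin 2) :
      G' *ᵥ (V2 *ᵥ enc q.1 q.2) = intermediateState q.1 q.2 := by
    have h := congrArg (· *ᵥ intermediateState q.1 q.2) hGinv
    simp only [← mulVec_mulVec (_ : Idx → ℂ) (G' * _), ← mulVec_mulVec (_ : Idx → ℂ) G',
      Pip_mulVec_intermediateState, compressed_H0'_mulVec_intermediateState] at h
    rw [hG, ← mulVec_mulVec, ← mulVec_mulVec, h, Pip_mulVec_intermediateState]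
  have hentry (p q : Fin 2 × Fin 2) : (Eencᴴ * V2 * G' * V2 * Eenc) p q
      = star (V2 *ᵥ enc p.1 p.2) ⬝ᵥ intermediateState q.1 q.2 := by
    have hE (r : Fin 2 × Fin 2) : Eenc *ᵥ Pi.single r 1 = enc r.1 r.2 := by
      ext t
      simp [Eenc]
    have hfactor : Eencᴴ * V2 * G' * V2 * Eenc = (V2 * Eenc)ᴴ * (G' * (V2 * Eenc)) := by
      rw [conjTranspose_mul, V2_conjTranspose]
      simp only [Matrix.mul_assoc]
    have hright : (G' * (V2 * Eenc)).col q = intermediateState q.1 q.2 := by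
      rw [← mulVec_single_one, ← mulVec_mulVec, ← mulVec_mulVec, hE, hcol]
    have hleft : (V2 * Eenc).col p = V2 *ᵥ enc p.1 p.2 := by
      rw [← mulVec_single_one, ← mulVec_mulVec, hE]
    rw [hfactor, ← hright, ← hleft]
    rfl
  ext ⟨b, b'⟩ ⟨c, c'⟩
  rw [Matrix.neg_apply, hentry, star_V2_mulVec_enc_dotProduct_intermediateState]
  rw [amp_zero_mul_amp_zero, amp_zero_mul_amp_zero, amp_form, amp_form]
  fin_cases b <;> fin_cases b' <;> fin_cases c <;> fin_cases c' <;>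
    simp [PX, one_apply] <;> norm_num

end
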